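/- Let d, T be natural numbers with 2 ≤ T. For each t ∈ {1, …, T} let q t : (Fin d → ℝ) → (Fin d → ℝ) → ℝ be measurable, strictly positive, and a probability density in its second argument (∫ q t z w dw = 1 for every z), with respect to Lebesgue measure. Fix z0 : Fin d → ℝ; define the joint forward density Q z = ∏_{t=1}^{T} q t (z_{t−1}) (z_t) on trajectories z : Fin T → (Fin d → ℝ) (with z_0 := z0), marginals m 1 = q 1 z0 and m t b = ∫ m (t−1) a • q t a b da for 2 ≤ t ≤ T, and posteriors post t zt a = q t a zt • m (t−1) a / m t zt for 2 ≤ t ≤ T. Let pT : (Fin d → ℝ) → ℝ and p t : (Fin d → ℝ) → (Fin d → ℝ) → ℝ (1 ≤ t ≤ T) be measurable strictly positive densities. Assume every integrand appearing below is integrable. Then ∫ Q z • Real.log ((pT (z_T) • p 1 (z_1) z0 • ∏_{t=2}^{T} p t (z_t) (z_{t−1})) / Q z) dz = ∫ m 1 z1 • Real.log (p 1 z1 z0) dz1 + ∫ m T z • Real.log (pT z / m T z) dz + ∑_{t=2}^{T} ∫ m t zt • (∫ post t zt a • Real.log (p t zt a / post t zt a) da) dzt. -/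

import Mathlib

open MeasureTheory

/-- Extend a trajectory `z : Fin T → α` (holding `z_1, …, z_T`) to an index `t : ℕ`,
with `z_0 := z0`. -/
def traj {α : Type*} {T : ℕ} (z0 : α) (z : Fin T → α) (t : ℕ) : α :=
  if h : 1 ≤ t ∧ t ≤ T then z ⟨t - 1, by omega⟩ else z0

/-- Time-`t` marginal density of the forward Markov process started at `z0`:
`m 1 = q 1 z0` and `m t b = ∫ m (t-1) a • q t a b da` for `t ≥ 2`. -/
noncomputable def marg {d : ℕ} (q : ℕ → (Fin d → ℝ) → (Fin d → ℝ) → ℝ)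
    (z0 : Fin d → ℝ) : ℕ → (Fin d → ℝ) → ℝ
  | 0 => fun _ => 0
  | 1 => q 1 z0
  | (t + 2) => fun b => ∫ a, marg q z0 (t + 1) a • q (t + 2) a b

/-- One-step forward posterior density of `z_{t-1}` given `z_t` (and `z_0`):
`post t zt a = q t a zt • m (t-1) a / m t zt`. -/
noncomputable def post {d : ℕ} (q : ℕ → (Fin d → ℝ) → (Fin d → ℝ) → ℝ)
    (z0 : Fin d → ℝ) (t : ℕ) (zt a : Fin d → ℝ) : ℝ :=
  q t a zt • marg q z0 (t - 1) a / marg q z0 t zt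


section aux

lemma traj_meas {d n : ℕ} (z0 : Fin d → ℝ) (t : ℕ) :
    Measurable (fun z : Fin n → (Fin d → ℝ) => traj z0 z t) := by
  unfold traj
  split_ifs
  · exact measurable_pi_apply _
  · exact measurable_const

lemma traj_snoc_le {α : Type*} {n : ℕ} (z0 : α) (w : Fin n → α) (b : α) (t : ℕ) (ht : t ≤ n) :
    traj z0 (Fin.snoc w b : Fin (n+1) → α) t = traj z0 w t := by
  unfold traj
  by_cases h : 1 ≤ t
  · rw [dif_pos ⟨h, by omega⟩, dif_pos ⟨h, ht⟩]
    have : (⟨t - 1, by omega⟩ : Fin (n+1)) = Fin.castSucc ⟨t - 1, by omega⟩ := rfl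
    rw [this, Fin.snoc_castSucc (α := fun _ => α)]
  · rw [dif_neg (by omega), dif_neg (by omega)]

lemma traj_snoc_last {α : Type*} {n : ℕ} (z0 : α) (w : Fin n → α) (b : α) :
    traj z0 (Fin.snoc w b : Fin (n+1) → α) (n+1) = b := by
  unfold traj
  rw [dif_pos ⟨by omega, by omega⟩]
  have : (⟨n + 1 - 1, by omega⟩ : Fin (n+1)) = Fin.last n := rfl
  rw [this, Fin.snoc_last (α := fun _ => α)]

lemma lint_snoc {d n : ℕ} (F : (Fin (n+1) → (Fin d → ℝ)) → ENNReal) (hF : Measurable F) :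
    ∫⁻ z, F z = ∫⁻ w : Fin n → (Fin d → ℝ), ∫⁻ b, F (Fin.snoc w b : Fin (n+1) → (Fin d → ℝ)) := by
  have h := (volume_preserving_piFinSuccAbove (fun _ : Fin (n+1) => (Fin d → ℝ)) (Fin.last n)).symm
  rw [← h.lintegral_comp hF]
  erw [Measure.volume_eq_prod, lintegral_prod_symm' _ (hF.comp (MeasurableEquiv.measurable _))]
  simp [MeasurableEquiv.piFinSuccAbove, Fin.insertNthEquiv]

/-- joint forward density -/
noncomputable def Qd {d : ℕ} (q : ℕ → (Fin d → ℝ) → (Fin d → ℝ) → ℝ)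
    (z0 : Fin d → ℝ) (n : ℕ) (z : Fin n → (Fin d → ℝ)) : ℝ :=
  ∏ t ∈ Finset.Icc 1 n, q t (traj z0 z (t - 1)) (traj z0 z t)

/-- forward law -/
noncomputable def nu {d : ℕ} (q : ℕ → (Fin d → ℝ) → (Fin d → ℝ) → ℝ)
    (z0 : Fin d → ℝ) (n : ℕ) : Measure (Fin n → (Fin d → ℝ)) :=
  volume.withDensity (fun z => ENNReal.ofReal (Qd q z0 n z))

variable {d T : ℕ} {q : ℕ → (Fin d → ℝ) → (Fin d → ℝ) → ℝ} {z0 : Fin d → ℝ}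

lemma Qd_meas (hqmeas : ∀ t, 1 ≤ t → t ≤ T →
      Measurable (fun pr : (Fin d → ℝ) × (Fin d → ℝ) => q t pr.1 pr.2)) (n : ℕ) (hn : n ≤ T) :
    Measurable (Qd q z0 n) := by
  unfold Qd
  refine Finset.measurable_fun_prod _ fun t ht => ?_
  rw [Finset.mem_Icc] at ht
  exact (hqmeas t ht.1 (by omega)).comp ((traj_meas z0 _).prodMk (traj_meas z0 _))

lemma Qd_pos (hqpos : ∀ t, 1 ≤ t → t ≤ T → ∀ z w, 0 < q t z w) (n : ℕ) (hn : n ≤ T) (z) :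
    0 < Qd q z0 n z := by
  refine Finset.prod_pos fun t ht => ?_
  rw [Finset.mem_Icc] at ht
  exact hqpos t ht.1 (by omega) _ _

lemma Qd_snoc (n : ℕ) (w : Fin n → (Fin d → ℝ)) (b : Fin d → ℝ) :
    Qd q z0 (n+1) (Fin.snoc w b : Fin (n+1) → (Fin d → ℝ))
      = Qd q z0 n w * q (n+1) (traj z0 w n) b := by
  unfold Qd
  rw [Finset.prod_Icc_succ_top (by omega), traj_snoc_last]
  congr 1
  · refine Finset.prod_congr rfl fun t ht => ?_
    rw [Finset.mem_Icc] at ht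
    rw [traj_snoc_le _ _ _ _ (by omega), traj_snoc_le _ _ _ _ (by omega)]
  · rw [Nat.add_sub_cancel, traj_snoc_le _ _ _ _ le_rfl]

lemma q_lint (hqpos : ∀ t, 1 ≤ t → t ≤ T → ∀ z w, 0 < q t z w)
    (hqdens : ∀ t, 1 ≤ t → t ≤ T → ∀ z, (∫ w, q t z w) = 1) (t : ℕ) (h1 : 1 ≤ t) (h2 : t ≤ T) (z) :
    ∫⁻ w, ENNReal.ofReal (q t z w) = 1 := by
  rw [← ofReal_integral_eq_lintegral_ofReal, hqdens t h1 h2, ENNReal.ofReal_one]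
  · by_contra h
    have := hqdens t h1 h2 z
    rw [integral_undef h] at this
    norm_num at this
  · exact Filter.Eventually.of_forall fun w => (hqpos t h1 h2 z w).le

lemma nu_lint_snoc (hqmeas : ∀ t, 1 ≤ t → t ≤ T →
      Measurable (fun pr : (Fin d → ℝ) × (Fin d → ℝ) => q t pr.1 pr.2))
    (hqpos : ∀ t, 1 ≤ t → t ≤ T → ∀ z w, 0 < q t z w) (n : ℕ) (hn : n + 1 ≤ T)
    (F : (Fin (n+1) → (Fin d → ℝ)) → ENNReal) (hF : Measurable F) :
    ∫⁻ z, F z ∂(nu q z0 (n+1)) = ∫⁻ w, ∫⁻ b, ENNReal.ofReal (q (n+1) (traj z0 w n) b) *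
      F (Fin.snoc w b : Fin (n+1) → (Fin d → ℝ)) ∂(volume) ∂(nu q z0 n) := by
  have hsn : Measurable (fun x : (Fin n → (Fin d → ℝ)) × (Fin d → ℝ) =>
      (Fin.snoc x.1 x.2 : Fin (n+1) → (Fin d → ℝ))) := by
    refine measurable_pi_lambda _ fun i => ?_
    refine Fin.lastCases ?_ (fun j => ?_) i
    · simpa using measurable_snd
    · simp only [Fin.snoc_castSucc]
      exact (measurable_pi_apply j).comp measurable_fst
  have hQ := Qd_meas (z0 := z0) hqmeas (n+1) hn
  have hQn := Qd_meas (z0 := z0) hqmeas n (by omega)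
  have hqn := hqmeas (n+1) (by omega) hn
  have hk : Measurable (fun x : (Fin n → (Fin d → ℝ)) × (Fin d → ℝ) =>
      ENNReal.ofReal (q (n+1) (traj z0 x.1 n) x.2) *
      F (Fin.snoc x.1 x.2 : Fin (n+1) → (Fin d → ℝ))) := by
    refine Measurable.mul ?_ (hF.comp hsn)
    exact (hqn.comp (((traj_meas z0 n).comp measurable_fst).prodMk measurable_snd)).ennreal_ofReal
  unfold nu
  rw [lintegral_withDensity_eq_lintegral_mul _ hQ.ennreal_ofReal hF,
    lint_snoc _ (hQ.ennreal_ofReal.mul hF),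
    lintegral_withDensity_eq_lintegral_mul _ hQn.ennreal_ofReal hk.lintegral_prod_right']
  refine lintegral_congr fun w => ?_
  simp only [Pi.mul_apply]
  have hk2 : Measurable (fun b => ENNReal.ofReal (q (n+1) (traj z0 w n) b) *
      F (Fin.snoc w b : Fin (n+1) → (Fin d → ℝ))) := hk.comp measurable_prodMk_left
  rw [← lintegral_const_mul _ hk2]
  refine lintegral_congr fun b => ?_
  rw [Qd_snoc, ENNReal.ofReal_mul (Qd_pos hqpos n (by omega) w).le, mul_assoc]

/-- a functional of the first `n` coordinates has the same law -/
lemma nu_map_step (hqmeas : ∀ t, 1 ≤ t → t ≤ T →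
      Measurable (fun pr : (Fin d → ℝ) × (Fin d → ℝ) => q t pr.1 pr.2))
    (hqpos : ∀ t, 1 ≤ t → t ≤ T → ∀ z w, 0 < q t z w)
    (hqdens : ∀ t, 1 ≤ t → t ≤ T → ∀ z, (∫ w, q t z w) = 1) (n : ℕ) (hn : n + 1 ≤ T)
    {X : Type*} [MeasurableSpace X] (g : (Fin (n+1) → (Fin d → ℝ)) → X) (hg : Measurable g)
    (g' : (Fin n → (Fin d → ℝ)) → X) (hg' : Measurable g')
    (h : ∀ w b, g (Fin.snoc w b : Fin (n+1) → (Fin d → ℝ)) = g' w) :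
    (nu q z0 (n+1)).map g = (nu q z0 n).map g' := by
  refine Measure.ext_of_lintegral _ fun f hf => ?_
  rw [lintegral_map hf hg, lintegral_map hf hg', nu_lint_snoc hqmeas hqpos n hn (fun z => f (g z)) (hf.comp hg)]
  refine lintegral_congr fun w => ?_
  simp only [h]
  rw [lintegral_mul_const, q_lint hqpos hqdens (n+1) (by omega) hn, one_mul]
  exact ((hqmeas (n+1) (by omega) hn).comp measurable_prodMk_left).ennreal_ofReal

lemma marg_nonneg (hqpos : ∀ t, 1 ≤ t → t ≤ T → ∀ z w, 0 < q t z w) :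
    ∀ t, t ≤ T → ∀ b, 0 ≤ marg q z0 t b
  | 0, _, b => le_rfl
  | 1, h, b => (hqpos 1 le_rfl h _ _).le
  | t + 2, h, b => by
    simp only [marg]
    exact integral_nonneg fun a => mul_nonneg (marg_nonneg hqpos (t+1) (by omega) a)
      (hqpos _ (by omega) h _ _).le

lemma marg_meas (hqmeas : ∀ t, 1 ≤ t → t ≤ T →
      Measurable (fun pr : (Fin d → ℝ) × (Fin d → ℝ) => q t pr.1 pr.2)) :
    ∀ t, t ≤ T → Measurable (marg q z0 t)
  | 0, _ => measurable_const
  | 1, h => (hqmeas 1 le_rfl h).comp measurable_prodMk_left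
  | t + 2, h => by
    have h1 : Measurable (fun x : (Fin d → ℝ) × (Fin d → ℝ) =>
        marg q z0 (t + 1) x.1 • q (t + 2) x.1 x.2) :=
      ((marg_meas hqmeas (t+1) (by omega)).comp measurable_fst).smul (hqmeas (t+2) (by omega) h)
    exact (h1.stronglyMeasurable.integral_prod_left' (μ := volume)).measurable

/-- marginal facts -/
lemma marg_facts (hqmeas : ∀ t, 1 ≤ t → t ≤ T →
      Measurable (fun pr : (Fin d → ℝ) × (Fin d → ℝ) => q t pr.1 pr.2))
    (hqpos : ∀ t, 1 ≤ t → t ≤ T → ∀ z w, 0 < q t z w)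
    (hqdens : ∀ t, 1 ≤ t → t ≤ T → ∀ z, (∫ w, q t z w) = 1) (n : ℕ) (h1 : 1 ≤ n) (hn : n + 1 ≤ T)
    (hm : ∫⁻ b, ENNReal.ofReal (marg q z0 n b) = 1) :
    (∀ᵐ b, ∫⁻ a, ENNReal.ofReal (marg q z0 n a * q (n+1) a b)
      = ENNReal.ofReal (marg q z0 (n+1) b)) ∧
    ∫⁻ b, ENNReal.ofReal (marg q z0 (n+1) b) = 1 := by
  have hmm := marg_meas (z0 := z0) hqmeas n (by omega)
  have hk : Measurable (fun x : (Fin d → ℝ) × (Fin d → ℝ) => marg q z0 n x.1 * q (n+1) x.1 x.2) :=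
    (hmm.comp measurable_fst).mul (hqmeas (n+1) (by omega) hn)
  have hnn := fun a b => mul_nonneg (marg_nonneg (z0 := z0) hqpos n (by omega) a)
    (hqpos (n+1) (by omega) hn a b).le
  have htot : ∫⁻ b, ∫⁻ a, ENNReal.ofReal (marg q z0 n a * q (n+1) a b) = 1 := by
    rw [lintegral_lintegral_swap (f := fun b a => ENNReal.ofReal (marg q z0 n a * q (n+1) a b))
      (hk.comp measurable_swap).ennreal_ofReal.aemeasurable, ← hm]
    refine lintegral_congr fun a => ?_
    simp_rw [ENNReal.ofReal_mul (marg_nonneg (z0 := z0) hqpos n (by omega) a)]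
    rw [lintegral_const_mul, q_lint hqpos hqdens (n+1) (by omega) hn, mul_one]
    exact ((hqmeas (n+1) (by omega) hn).comp measurable_prodMk_left).ennreal_ofReal
  have hae : ∀ᵐ b, ∫⁻ a, ENNReal.ofReal (marg q z0 n a * q (n+1) a b)
      = ENNReal.ofReal (marg q z0 (n+1) b) := by
    have hlt := ae_lt_top (μ := volume)
      (f := fun b => ∫⁻ a, ENNReal.ofReal (marg q z0 n a * q (n+1) a b))
      (hk.ennreal_ofReal.lintegral_prod_left' (μ := volume)) (by rw [htot]; simp)
    filter_upwards [hlt] with b hb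
    obtain ⟨k, rfl⟩ : ∃ k, n = k + 1 := ⟨n - 1, by omega⟩
    simp only [marg, smul_eq_mul]
    rw [ofReal_integral_eq_lintegral_ofReal]
    · refine ⟨(hk.comp measurable_prodMk_right).aestronglyMeasurable, ?_⟩
      rw [hasFiniteIntegral_iff_ofReal (Filter.Eventually.of_forall fun a => hnn a b)]
      exact hb
    · exact Filter.Eventually.of_forall fun a => hnn a b
  refine ⟨hae, ?_⟩
  rw [← htot]
  exact (lintegral_congr_ae hae).symm

lemma marg_lint (hqmeas : ∀ t, 1 ≤ t → t ≤ T →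
      Measurable (fun pr : (Fin d → ℝ) × (Fin d → ℝ) => q t pr.1 pr.2))
    (hqpos : ∀ t, 1 ≤ t → t ≤ T → ∀ z w, 0 < q t z w)
    (hqdens : ∀ t, 1 ≤ t → t ≤ T → ∀ z, (∫ w, q t z w) = 1) (n : ℕ) (h1 : 1 ≤ n) (hn : n ≤ T) :
    ∫⁻ b, ENNReal.ofReal (marg q z0 n b) = 1 := by
  induction n, h1 using Nat.le_induction with
  | base => exact q_lint hqpos hqdens 1 le_rfl hn z0
  | succ n h ih => exact (marg_facts hqmeas hqpos hqdens n h hn (ih (by omega))).2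

lemma marg_pos (hqmeas : ∀ t, 1 ≤ t → t ≤ T →
      Measurable (fun pr : (Fin d → ℝ) × (Fin d → ℝ) => q t pr.1 pr.2))
    (hqpos : ∀ t, 1 ≤ t → t ≤ T → ∀ z w, 0 < q t z w)
    (hqdens : ∀ t, 1 ≤ t → t ≤ T → ∀ z, (∫ w, q t z w) = 1) (n : ℕ) (h1 : 1 ≤ n) (hn : n ≤ T) :
    ∀ᵐ b, 0 < marg q z0 n b := by
  induction n, h1 using Nat.le_induction with
  | base => exact Filter.Eventually.of_forall fun b => hqpos 1 le_rfl hn _ _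
  | succ n h ih =>
    have hmm := marg_meas (z0 := z0) hqmeas n (by omega)
    have hk : Measurable (fun x : (Fin d → ℝ) × (Fin d → ℝ) =>
        marg q z0 n x.1 * q (n+1) x.1 x.2) :=
      (hmm.comp measurable_fst).mul (hqmeas (n+1) (by omega) hn)
    filter_upwards [(marg_facts hqmeas hqpos hqdens n h hn
      (marg_lint hqmeas hqpos hqdens n h (by omega))).1] with b hb
    rw [← ENNReal.ofReal_pos, ← hb, pos_iff_ne_zero]
    intro h0
    have hk2 : Measurable (fun a => ENNReal.ofReal (marg q z0 n a * q (n+1) a b)) :=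
      (hk.comp measurable_prodMk_right).ennreal_ofReal
    rw [lintegral_eq_zero_iff hk2] at h0
    have : ∀ᵐ a : Fin d → ℝ, False := by
      filter_upwards [h0, ih (by omega)] with a ha ha'
      simp only [Function.comp, Pi.zero_apply, ENNReal.ofReal_eq_zero] at ha
      exact absurd ha (not_le.2 (mul_pos ha' (hqpos (n+1) (by omega) hn a b)))
    rw [Filter.eventually_false_iff_eq_bot, ae_eq_bot] at this
    exact NeZero.ne _ this

/-- density of the pair -/
noncomputable def kd (q : ℕ → (Fin d → ℝ) → (Fin d → ℝ) → ℝ) (z0 : Fin d → ℝ) (n : ℕ)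
    (x : (Fin d → ℝ) × (Fin d → ℝ)) : ℝ := marg q z0 n x.1 * q (n+1) x.1 x.2

lemma kd_meas (hqmeas : ∀ t, 1 ≤ t → t ≤ T →
      Measurable (fun pr : (Fin d → ℝ) × (Fin d → ℝ) => q t pr.1 pr.2)) (n : ℕ) (hn : n + 1 ≤ T) :
    Measurable (kd q z0 n) :=
  ((marg_meas (z0 := z0) hqmeas n (by omega)).comp measurable_fst).mul (hqmeas (n+1) (by omega) hn)

lemma pair_of_last (hqmeas : ∀ t, 1 ≤ t → t ≤ T →
      Measurable (fun pr : (Fin d → ℝ) × (Fin d → ℝ) => q t pr.1 pr.2))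
    (hqpos : ∀ t, 1 ≤ t → t ≤ T → ∀ z w, 0 < q t z w) (n : ℕ) (hn : n + 1 ≤ T)
    (hl : (nu q z0 n).map (fun z => traj z0 z n)
      = volume.withDensity (fun b => ENNReal.ofReal (marg q z0 n b))) :
    (nu q z0 (n+1)).map (fun z => (traj z0 z n, traj z0 z (n+1))) =
      (volume.prod volume).withDensity (fun x => ENNReal.ofReal (kd q z0 n x)) := by
  have hpm : Measurable (fun z : Fin (n+1) → (Fin d → ℝ) => (traj z0 z n, traj z0 z (n+1))) :=
    (traj_meas z0 _).prodMk (traj_meas z0 _)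
  have hkm := kd_meas (z0 := z0) hqmeas n hn
  have hqm := hqmeas (n+1) (by omega) hn
  refine Measure.ext_of_lintegral _ fun f hf => ?_
  have hh : Measurable (fun x : (Fin d → ℝ) × (Fin d → ℝ) =>
    ENNReal.ofReal (q (n+1) x.1 x.2) * f x) := hqm.ennreal_ofReal.mul hf
  have hH : Measurable (fun a : Fin d → ℝ => ∫⁻ b, ENNReal.ofReal (q (n+1) a b) * f (a, b)) :=
    hh.lintegral_prod_right' (ν := volume)
  rw [lintegral_map hf hpm, nu_lint_snoc hqmeas hqpos n hn
      (fun z => f (traj z0 z n, traj z0 z (n+1))) (hf.comp hpm),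
    lintegral_withDensity_eq_lintegral_mul _ hkm.ennreal_ofReal hf,
    lintegral_prod _ (hkm.ennreal_ofReal.mul hf).aemeasurable]
  simp only [traj_snoc_last, traj_snoc_le _ _ _ _ (le_refl n)]
  rw [← lintegral_map (μ := nu q z0 n) (f := fun a => ∫⁻ b, ENNReal.ofReal (q (n+1) a b) * f (a, b))
    hH (traj_meas z0 n), hl, lintegral_withDensity_eq_lintegral_mul _
      (marg_meas (z0 := z0) hqmeas n (by omega)).ennreal_ofReal hH]
  refine lintegral_congr fun a => ?_
  simp only [Pi.mul_apply, kd]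
  have hh2 : Measurable (fun b => ENNReal.ofReal (q (n+1) a b) * f (a, b)) :=
    hh.comp measurable_prodMk_left
  rw [← lintegral_const_mul _ hh2]
  refine lintegral_congr fun b => ?_
  rw [ENNReal.ofReal_mul (marg_nonneg (z0 := z0) hqpos n (by omega) a), mul_assoc]

lemma last_law (hqmeas : ∀ t, 1 ≤ t → t ≤ T →
      Measurable (fun pr : (Fin d → ℝ) × (Fin d → ℝ) => q t pr.1 pr.2))
    (hqpos : ∀ t, 1 ≤ t → t ≤ T → ∀ z w, 0 < q t z w)
    (hqdens : ∀ t, 1 ≤ t → t ≤ T → ∀ z, (∫ w, q t z w) = 1) (n : ℕ) (h1 : 1 ≤ n) (hn : n ≤ T) :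
    (nu q z0 n).map (fun z => traj z0 z n)
      = volume.withDensity (fun b => ENNReal.ofReal (marg q z0 n b)) := by
  induction n, h1 using Nat.le_induction with
  | base =>
    refine Measure.ext_of_lintegral _ fun f hf => ?_
    have hm := (marg_meas (z0 := z0) hqmeas 1 hn)
    rw [lintegral_map hf (traj_meas z0 1), nu_lint_snoc hqmeas hqpos 0 hn (fun z => f (traj z0 z 1))
      (hf.comp (traj_meas z0 1)), lintegral_withDensity_eq_lintegral_mul _ hm.ennreal_ofReal hf]
    have e : ∀ w : Fin 0 → (Fin d → ℝ), traj z0 w 0 = z0 := fun w => by simp [traj]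
    have hnu : (nu q z0 0) Set.univ = 1 := by
      simp [nu, Qd, volume_pi, Measure.pi_of_empty]
    have e2 := fun (w : Fin 0 → (Fin d → ℝ)) b => traj_snoc_last z0 w b
    simp only [Nat.zero_add] at e2 ⊢
    simp only [e, e2]
    rw [lintegral_const, hnu, mul_one]
    rfl
  | succ n h ih =>
    have hp := pair_of_last hqmeas hqpos n hn (ih (by omega))
    have hkm := kd_meas (z0 := z0) hqmeas n hn
    have : (nu q z0 (n+1)).map (fun z => traj z0 z (n+1)) =
        ((nu q z0 (n+1)).map (fun z => (traj z0 z n, traj z0 z (n+1)))).map Prod.snd := by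
      rw [Measure.map_map measurable_snd ((traj_meas z0 _).prodMk (traj_meas z0 _))]
      rfl
    rw [this, hp]
    refine Measure.ext_of_lintegral _ fun f hf => ?_
    have hf2 : Measurable (fun x : (Fin d → ℝ) × (Fin d → ℝ) => f x.2) := hf.comp measurable_snd
    rw [lintegral_map hf measurable_snd,
      lintegral_withDensity_eq_lintegral_mul _ hkm.ennreal_ofReal hf2,
      lintegral_prod_symm _ (hkm.ennreal_ofReal.mul hf2).aemeasurable,
      lintegral_withDensity_eq_lintegral_mul _
        (marg_meas (z0 := z0) hqmeas (n+1) hn).ennreal_ofReal hf]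
    refine lintegral_congr_ae ?_
    filter_upwards [(marg_facts hqmeas hqpos hqdens n h hn
      (marg_lint hqmeas hqpos hqdens n h (by omega))).1] with b hb
    simp only [Pi.mul_apply]
    have hk2 : Measurable (fun a => ENNReal.ofReal (kd q z0 n (a, b))) :=
      (hkm.comp measurable_prodMk_right).ennreal_ofReal
    rw [lintegral_mul_const _ hk2, ← hb]
    rfl

lemma single_law (hqmeas : ∀ t, 1 ≤ t → t ≤ T →
      Measurable (fun pr : (Fin d → ℝ) × (Fin d → ℝ) => q t pr.1 pr.2))
    (hqpos : ∀ t, 1 ≤ t → t ≤ T → ∀ z w, 0 < q t z w)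
    (hqdens : ∀ t, 1 ≤ t → t ≤ T → ∀ z, (∫ w, q t z w) = 1) (n : ℕ) (h1 : 1 ≤ n)
    (N : ℕ) (hN : n ≤ N) (hT : N ≤ T) :
    (nu q z0 N).map (fun z => traj z0 z n)
      = volume.withDensity (fun b => ENNReal.ofReal (marg q z0 n b)) := by
  induction N, hN using Nat.le_induction with
  | base => exact last_law hqmeas hqpos hqdens n h1 hT
  | succ N h ih =>
    rw [← ih (by omega)]
    exact nu_map_step hqmeas hqpos hqdens N hT _ (traj_meas z0 _) _ (traj_meas z0 _)
      fun w b => traj_snoc_le _ _ _ _ h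

lemma pair_law (hqmeas : ∀ t, 1 ≤ t → t ≤ T →
      Measurable (fun pr : (Fin d → ℝ) × (Fin d → ℝ) => q t pr.1 pr.2))
    (hqpos : ∀ t, 1 ≤ t → t ≤ T → ∀ z w, 0 < q t z w)
    (hqdens : ∀ t, 1 ≤ t → t ≤ T → ∀ z, (∫ w, q t z w) = 1) (n : ℕ) (h1 : 1 ≤ n)
    (N : ℕ) (hN : n + 1 ≤ N) (hT : N ≤ T) :
    (nu q z0 N).map (fun z => (traj z0 z n, traj z0 z (n+1))) =
      (volume.prod volume).withDensity (fun x => ENNReal.ofReal (kd q z0 n x)) := by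
  induction N, hN using Nat.le_induction with
  | base => exact pair_of_last hqmeas hqpos n hT (last_law hqmeas hqpos hqdens n h1 (by omega))
  | succ N h ih =>
    rw [← ih (by omega)]
    exact nu_map_step hqmeas hqpos hqdens N hT _ ((traj_meas z0 _).prodMk (traj_meas z0 _)) _
      ((traj_meas z0 _).prodMk (traj_meas z0 _))
      fun w b => by rw [traj_snoc_le _ _ _ _ h, traj_snoc_le _ _ _ _ (by omega)]

/-- transfer of integrals -/
lemma transfer {Z X : Type*} [MeasurableSpace Z] [MeasurableSpace X] (ν : Measure Z) (μ : Measure X)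
    (g : Z → X) (hg : Measurable g) (k : X → ℝ) (hk : Measurable k) (hk0 : ∀ x, 0 ≤ k x)
    (h : ν.map g = μ.withDensity (fun x => ENNReal.ofReal (k x)))
    (f : X → ℝ) (hf : Measurable f) (hi : Integrable (fun x => k x * f x) μ) :
    Integrable (fun z => f (g z)) ν ∧ ∫ z, f (g z) ∂ν = ∫ x, k x * f x ∂μ := by
  constructor
  · have : Integrable f (ν.map g) := by
      rw [h, integrable_withDensity_iff_integrable_smul' hk.ennreal_ofReal
        (Filter.Eventually.of_forall fun x => ENNReal.ofReal_lt_top)]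
      simpa [ENNReal.toReal_ofReal (hk0 _)] using hi
    exact this.comp_measurable hg
  · rw [← integral_map hg.aemeasurable hf.aestronglyMeasurable, h,
      integral_withDensity_eq_integral_toReal_smul hk.ennreal_ofReal
        (Filter.Eventually.of_forall fun x => ENNReal.ofReal_lt_top)]
    simp [ENNReal.toReal_ofReal (hk0 _)]

lemma post_meas (hqmeas : ∀ t, 1 ≤ t → t ≤ T →
      Measurable (fun pr : (Fin d → ℝ) × (Fin d → ℝ) => q t pr.1 pr.2)) (n : ℕ) (hn : n + 1 ≤ T) :
    Measurable (fun x : (Fin d → ℝ) × (Fin d → ℝ) => post q z0 (n+1) x.2 x.1) := by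
  unfold post
  exact ((hqmeas (n+1) (by omega) hn).smul ((marg_meas hqmeas n (by omega)).comp measurable_fst)).div
    ((marg_meas hqmeas (n+1) hn).comp measurable_snd)

lemma kl_bound (x p : ℝ) (hx : 0 ≤ x) (hp : 0 < p) :
    |x * Real.log (p / x)| ≤ 2 * p - x * Real.log (p / x) := by
  have h : x * Real.log (p / x) ≤ p := by
    rcases hx.eq_or_lt with rfl | hx
    · simp [hp.le]
    · have := Real.log_le_sub_one_of_pos (div_pos hp hx)
      calc x * Real.log (p / x) ≤ x * (p / x - 1) := by gcongr
        _ = p - x := by field_simp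
        _ ≤ p := by linarith
  rw [abs_le]; constructor <;> linarith

lemma kl_term (hqmeas : ∀ t, 1 ≤ t → t ≤ T →
      Measurable (fun pr : (Fin d → ℝ) × (Fin d → ℝ) => q t pr.1 pr.2))
    (hqpos : ∀ t, 1 ≤ t → t ≤ T → ∀ z w, 0 < q t z w)
    (hqdens : ∀ t, 1 ≤ t → t ≤ T → ∀ z, (∫ w, q t z w) = 1) (n : ℕ) (h1 : 1 ≤ n)
    (hn : n + 1 ≤ T) (p : (Fin d → ℝ) → (Fin d → ℝ) → ℝ)
    (hpmeas : Measurable (fun pr : (Fin d → ℝ) × (Fin d → ℝ) => p pr.1 pr.2))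
    (hppos : ∀ z w, 0 < p z w)
    (hpdens : ∀ z, (∫ w, p z w) = 1)
    (hin : ∀ zt, Integrable
      (fun a => post q z0 (n+1) zt a • Real.log (p zt a / post q z0 (n+1) zt a)))
    (hout : Integrable (fun zt => marg q z0 (n+1) zt •
      ∫ a, post q z0 (n+1) zt a • Real.log (p zt a / post q z0 (n+1) zt a))) :
    Integrable (fun x : (Fin d → ℝ) × (Fin d → ℝ) =>
      kd q z0 n x * Real.log (p x.2 x.1 / post q z0 (n+1) x.2 x.1)) (volume.prod volume) ∧
    ∫ x : (Fin d → ℝ) × (Fin d → ℝ),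
      kd q z0 n x * Real.log (p x.2 x.1 / post q z0 (n+1) x.2 x.1) ∂(volume.prod volume) =
    ∫ zt, marg q z0 (n+1) zt •
      ∫ a, post q z0 (n+1) zt a • Real.log (p zt a / post q z0 (n+1) zt a) := by
  simp only [smul_eq_mul] at *
  have hfm : Measurable (fun x : (Fin d → ℝ) × (Fin d → ℝ) =>
      kd q z0 n x * Real.log (p x.2 x.1 / post q z0 (n+1) x.2 x.1)) :=
    (kd_meas hqmeas n hn).mul (((hpmeas.comp measurable_swap).div
      (post_meas hqmeas n hn)).log)
  have hpint : ∀ z, Integrable (p z) := fun z => by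
    by_contra h
    have := hpdens z
    rw [integral_undef h] at this
    norm_num at this
  have hpost0 : ∀ b a, 0 ≤ post q z0 (n+1) b a := fun b a =>
    div_nonneg (mul_nonneg (hqpos (n+1) (by omega) hn _ _).le
      (marg_nonneg hqpos _ (by simp; omega) _)) (marg_nonneg hqpos _ hn _)
  have hm0 := marg_nonneg (z0 := z0) hqpos (n+1) hn
  have hkey : ∀ᵐ b, ∀ a, kd q z0 n (a, b) * Real.log (p b a / post q z0 (n+1) b a) =
      marg q z0 (n+1) b * (post q z0 (n+1) b a * Real.log (p b a / post q z0 (n+1) b a)) := by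
    filter_upwards [marg_pos (z0 := z0) hqmeas hqpos hqdens (n+1) (by omega) hn] with b hb a
    rw [← mul_assoc]
    congr 1
    simp only [kd, post, smul_eq_mul, Nat.add_sub_cancel]
    field_simp
  have hmint : Integrable (marg q z0 (n+1)) := by
    refine ⟨(marg_meas hqmeas _ hn).aestronglyMeasurable, ?_⟩
    rw [hasFiniteIntegral_iff_ofReal (Filter.Eventually.of_forall hm0),
      marg_lint hqmeas hqpos hqdens (n+1) (by omega) hn]
    simp
  have hI : Integrable (fun x : (Fin d → ℝ) × (Fin d → ℝ) =>
      kd q z0 n x * Real.log (p x.2 x.1 / post q z0 (n+1) x.2 x.1)) (volume.prod volume) := by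
    rw [integrable_prod_iff' hfm.aestronglyMeasurable]
    constructor
    · filter_upwards [hkey] with b hb
      simp only [hb]
      exact (hin b).const_mul _
    · refine Integrable.mono' ((hmint.const_mul 2).sub hout) ?_ ?_
      · exact (hfm.norm.stronglyMeasurable.integral_prod_left' (μ := volume)).aestronglyMeasurable
      · filter_upwards [hkey] with b hb
        rw [Real.norm_of_nonneg (integral_nonneg fun _ => norm_nonneg _)]
        simp only [hb, norm_mul, Real.norm_of_nonneg (hm0 b), Pi.sub_apply]
        rw [integral_const_mul]
        have : ∫ a, ‖post q z0 (n+1) b a‖ * ‖Real.log (p b a / post q z0 (n+1) b a)‖ ≤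
            ∫ a, (2 * p b a - post q z0 (n+1) b a * Real.log (p b a / post q z0 (n+1) b a)) := by
          refine integral_mono ?_ (((hpint b).const_mul 2).sub (hin b)) fun a => ?_
          · simpa only [norm_mul] using (hin b).norm
          · have := kl_bound _ _ (hpost0 b a) (hppos b a)
            rw [abs_mul] at this
            exact this
        rw [integral_sub ((hpint b).const_mul 2) (hin b), integral_const_mul, hpdens] at this
        have := mul_le_mul_of_nonneg_left this (hm0 b)
        linarith
  refine ⟨hI, ?_⟩
  rw [integral_prod_symm _ hI]
  refine integral_congr_ae ?_
  filter_upwards [hkey] with b hb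
  simp only [hb]
  rw [integral_const_mul]

/-- pointwise log identity -/
lemma log_id (T : ℕ) (hT : 1 ≤ T) (Q P M : ℕ → ℝ) (c e : ℝ) (hc : 0 < c) (he : 0 < e)
    (hQ : ∀ t, 1 ≤ t → t ≤ T → 0 < Q t) (hP : ∀ t, 1 ≤ t → t ≤ T → 0 < P t)
    (hM : ∀ t, 1 ≤ t → t ≤ T → 0 < M t) (h1 : M 1 = Q 1) :
    Real.log ((c * (e * ∏ t ∈ Finset.Icc 2 T, P t)) / ∏ t ∈ Finset.Icc 1 T, Q t) =
      Real.log e + Real.log (c / M T) +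
        ∑ t ∈ Finset.Icc 2 T, Real.log (P t / (Q t * M (t-1) / M t)) := by
  induction T, hT using Nat.le_induction with
  | base =>
    have := hQ 1 le_rfl le_rfl
    simp only [Finset.Icc_self, Finset.prod_singleton, h1]
    simp
    rw [← Real.log_mul he.ne' (div_pos hc this).ne']
    congr 1; ring
  | succ n h ih =>
    have ih := ih (fun t a b => hQ t a (by omega)) (fun t a b => hP t a (by omega))
      (fun t a b => hM t a (by omega))
    have hA : 0 < ∏ t ∈ Finset.Icc 2 n, P t := Finset.prod_pos fun t ht => by
      rw [Finset.mem_Icc] at ht; exact hP t (by omega) (by omega)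
    have hB : 0 < ∏ t ∈ Finset.Icc 1 n, Q t := Finset.prod_pos fun t ht => by
      rw [Finset.mem_Icc] at ht; exact hQ t (by omega) (by omega)
    rw [Finset.prod_Icc_succ_top (by omega), Finset.prod_Icc_succ_top (by omega),
      Finset.sum_Icc_succ_top (by omega), Nat.add_sub_cancel]
    have q1 := hQ (n+1) (by omega) le_rfl
    have p1 := hP (n+1) (by omega) le_rfl
    have m1 := hM (n+1) (by omega) le_rfl
    have m0 := hM n (by omega) (by omega)
    generalize ∏ t ∈ Finset.Icc 2 n, P t = A at *
    generalize ∏ t ∈ Finset.Icc 1 n, Q t = B at *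
    have e1 : Real.log (c * (e * (A * P (n+1))) / (B * Q (n+1))) =
        Real.log (c * (e * A) / B) + (Real.log (P (n+1)) - Real.log (Q (n+1))) := by
      rw [← Real.log_div p1.ne' q1.ne', ← Real.log_mul (by positivity) (by positivity)]
      congr 1; field_simp
    rw [e1, ih, Real.log_div hc.ne' m1.ne', Real.log_div hc.ne' m0.ne',
      Real.log_div p1.ne' (by positivity), Real.log_div (by positivity) m1.ne',
      Real.log_mul q1.ne' m0.ne']
    ring

end aux


/-- decomposition of the diffusion evidence lower bound into a
reconstruction term, a prior-matching term, and per-timestep KL-type terms. -/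
theorem diffusion_elbo_decomposition (d T : ℕ) (hT : 2 ≤ T)
    (q : ℕ → (Fin d → ℝ) → (Fin d → ℝ) → ℝ)
    (hqmeas : ∀ t, 1 ≤ t → t ≤ T →
      Measurable (fun pr : (Fin d → ℝ) × (Fin d → ℝ) => q t pr.1 pr.2))
    (hqpos : ∀ t, 1 ≤ t → t ≤ T → ∀ z w, 0 < q t z w)
    (hqdens : ∀ t, 1 ≤ t → t ≤ T → ∀ z, (∫ w, q t z w) = 1)
    (z0 : Fin d → ℝ)
    (pT : (Fin d → ℝ) → ℝ) (p : ℕ → (Fin d → ℝ) → (Fin d → ℝ) → ℝ)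
    (hpTmeas : Measurable pT) (hpTpos : ∀ z, 0 < pT z) (hpTdens : (∫ z, pT z) = 1)
    (hpmeas : ∀ t, 1 ≤ t → t ≤ T →
      Measurable (fun pr : (Fin d → ℝ) × (Fin d → ℝ) => p t pr.1 pr.2))
    (hppos : ∀ t, 1 ≤ t → t ≤ T → ∀ z w, 0 < p t z w)
    (hpdens : ∀ t, 1 ≤ t → t ≤ T → ∀ z, (∫ w, p t z w) = 1)
    (hint_lhs : Integrable (fun z : Fin T → (Fin d → ℝ) =>
      (∏ t ∈ Finset.Icc 1 T, q t (traj z0 z (t - 1)) (traj z0 z t)) •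
        Real.log ((pT (traj z0 z T) • p 1 (traj z0 z 1) z0 •
            ∏ t ∈ Finset.Icc 2 T, p t (traj z0 z t) (traj z0 z (t - 1))) /
          (∏ t ∈ Finset.Icc 1 T, q t (traj z0 z (t - 1)) (traj z0 z t)))))
    (hint_rec : Integrable (fun z1 => marg q z0 1 z1 • Real.log (p 1 z1 z0)))
    (hint_prior : Integrable (fun z => marg q z0 T z • Real.log (pT z / marg q z0 T z)))
    (hint_kl_inner : ∀ t ∈ Finset.Icc 2 T, ∀ zt, Integrable
      (fun a => post q z0 t zt a • Real.log (p t zt a / post q z0 t zt a)))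
    (hint_kl_outer : ∀ t ∈ Finset.Icc 2 T, Integrable (fun zt => marg q z0 t zt •
      ∫ a, post q z0 t zt a • Real.log (p t zt a / post q z0 t zt a))) :
    (∫ z : Fin T → (Fin d → ℝ),
      (∏ t ∈ Finset.Icc 1 T, q t (traj z0 z (t - 1)) (traj z0 z t)) •
        Real.log ((pT (traj z0 z T) • p 1 (traj z0 z 1) z0 •
            ∏ t ∈ Finset.Icc 2 T, p t (traj z0 z t) (traj z0 z (t - 1))) /
          (∏ t ∈ Finset.Icc 1 T, q t (traj z0 z (t - 1)) (traj z0 z t)))) =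
      (∫ z1, marg q z0 1 z1 • Real.log (p 1 z1 z0)) +
      (∫ z, marg q z0 T z • Real.log (pT z / marg q z0 T z)) +
      ∑ t ∈ Finset.Icc 2 T, ∫ zt, marg q z0 t zt •
        (∫ a, post q z0 t zt a • Real.log (p t zt a / post q z0 t zt a)) := by
  have hTT := le_refl T
  have hmm := marg_meas (z0 := z0) hqmeas
  have hm0 := marg_nonneg (z0 := z0) hqpos
  have hA := transfer (nu q z0 T) volume (fun z => traj z0 z 1) (traj_meas z0 1) (marg q z0 1)
    (hmm 1 (by omega)) (hm0 1 (by omega))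
    (single_law hqmeas hqpos hqdens 1 le_rfl T (by omega) le_rfl)
    (fun z1 => Real.log (p 1 z1 z0))
    ((hpmeas 1 le_rfl (by omega)).comp measurable_prodMk_right).log hint_rec
  have hB := transfer (nu q z0 T) volume (fun z => traj z0 z T) (traj_meas z0 T) (marg q z0 T)
    (hmm T le_rfl) (hm0 T le_rfl)
    (single_law hqmeas hqpos hqdens T (by omega) T le_rfl le_rfl)
    (fun z => Real.log (pT z / marg q z0 T z))
    (hpTmeas.div (hmm T le_rfl)).log hint_prior
  have hC : ∀ t ∈ Finset.Icc 2 T,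
      Integrable (fun z => Real.log (p t (traj z0 z t) (traj z0 z (t-1)) /
        post q z0 t (traj z0 z t) (traj z0 z (t-1)))) (nu q z0 T) ∧
      ∫ z, Real.log (p t (traj z0 z t) (traj z0 z (t-1)) /
        post q z0 t (traj z0 z t) (traj z0 z (t-1))) ∂(nu q z0 T) =
      ∫ zt, marg q z0 t zt •
        (∫ a, post q z0 t zt a • Real.log (p t zt a / post q z0 t zt a)) := by
    intro t ht
    have hin := hint_kl_inner t ht
    have hout := hint_kl_outer t ht
    rw [Finset.mem_Icc] at ht
    obtain ⟨n, rfl⟩ : ∃ n, t = n + 1 := ⟨t - 1, by omega⟩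
    have hk := kl_term hqmeas hqpos hqdens n (by omega) ht.2 (p (n+1))
      (hpmeas _ (by omega) ht.2) (hppos _ (by omega) ht.2) (hpdens _ (by omega) ht.2) hin hout
    have := transfer (nu q z0 T) (volume.prod volume) (fun z => (traj z0 z n, traj z0 z (n+1)))
      ((traj_meas z0 _).prodMk (traj_meas z0 _)) (kd q z0 n) (kd_meas hqmeas n ht.2)
      (fun x => mul_nonneg (hm0 n (by omega) _) (hqpos _ (by omega) ht.2 _ _).le)
      (pair_law hqmeas hqpos hqdens n (by omega) T ht.2 le_rfl)
      (fun x => Real.log (p (n+1) x.2 x.1 / post q z0 (n+1) x.2 x.1))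
      (((hpmeas _ (by omega) ht.2).comp measurable_swap).div (post_meas hqmeas n ht.2)).log hk.1
    rw [hk.2] at this
    exact this
  have hae : ∀ᵐ z ∂(nu q z0 T), ∀ t ∈ Finset.Icc 1 T, 0 < marg q z0 t (traj z0 z t) := by
    rw [Filter.eventually_all_finset]
    intro t ht
    rw [Finset.mem_Icc] at ht
    have h1 := marg_pos (z0 := z0) hqmeas hqpos hqdens t ht.1 ht.2
    have h2 := (withDensity_absolutelyContinuous volume
      (fun b => ENNReal.ofReal (marg q z0 t b))).ae_le h1
    rw [← single_law hqmeas hqpos hqdens t ht.1 T ht.2 le_rfl] at h2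
    exact ae_of_ae_map (traj_meas z0 t).aemeasurable h2
  have hL : ∀ F : (Fin T → (Fin d → ℝ)) → ℝ,
      ∫ z, Qd q z0 T z • F z = ∫ z, F z ∂(nu q z0 T) := by
    intro F
    unfold nu
    rw [integral_withDensity_eq_integral_toReal_smul (Qd_meas hqmeas T le_rfl).ennreal_ofReal
        (Filter.Eventually.of_forall fun x => ENNReal.ofReal_lt_top)]
    simp only [ENNReal.toReal_ofReal (Qd_pos hqpos T le_rfl _).le]
  have hL' := hL (fun z => Real.log ((pT (traj z0 z T) • p 1 (traj z0 z 1) z0 •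
            ∏ t ∈ Finset.Icc 2 T, p t (traj z0 z t) (traj z0 z (t - 1))) /
          (∏ t ∈ Finset.Icc 1 T, q t (traj z0 z (t - 1)) (traj z0 z t))))
  refine Eq.trans hL' ?_
  have hsum : ∀ᵐ z ∂(nu q z0 T), Real.log ((pT (traj z0 z T) • p 1 (traj z0 z 1) z0 •
            ∏ t ∈ Finset.Icc 2 T, p t (traj z0 z t) (traj z0 z (t - 1))) /
          (∏ t ∈ Finset.Icc 1 T, q t (traj z0 z (t - 1)) (traj z0 z t))) =
      (Real.log (p 1 (traj z0 z 1) z0) +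
        Real.log (pT (traj z0 z T) / marg q z0 T (traj z0 z T))) +
      ∑ t ∈ Finset.Icc 2 T, Real.log (p t (traj z0 z t) (traj z0 z (t-1)) /
        post q z0 t (traj z0 z t) (traj z0 z (t-1))) := by
    filter_upwards [hae] with z hz
    exact log_id T (by omega) (fun t => q t (traj z0 z (t - 1)) (traj z0 z t))
      (fun t => p t (traj z0 z t) (traj z0 z (t - 1))) (fun t => marg q z0 t (traj z0 z t))
      _ _ (hpTpos _) (hppos 1 le_rfl (by omega) _ _) (fun t a b => hqpos t a b _ _)
      (fun t a b => hppos t a b _ _) (fun t a b => hz t (Finset.mem_Icc.2 ⟨a, b⟩))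
      (by simp [marg, traj])
  have hAB : Integrable (fun z => Real.log (p 1 (traj z0 z 1) z0) +
        Real.log (pT (traj z0 z T) / marg q z0 T (traj z0 z T))) (nu q z0 T) := hA.1.add hB.1
  rw [integral_congr_ae hsum, integral_add hAB
    (integrable_finsetSum _ fun t ht => (hC t ht).1), integral_add hA.1 hB.1,
    integral_finset_sum _ fun t ht => (hC t ht).1, hA.2, hB.2,
    Finset.sum_congr rfl fun t ht => (hC t ht).2]
  rfl
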